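/- Let H, H₁ be real separable Hilbert spaces and f : H → H₁ a map such that: (i) f is real analytic and df(q) is a linear isomorphism for every q ∈ H; (ii) there exists a nondecreasing ε : [0,∞) → [0,∞) with ε(0)=0 and ‖q‖ ≤ ε(‖f(q)‖₁) for all q ∈ H; (iii) there exists a linear isomorphism f₀ : H → H₁ with f − f₀ compact (maps weakly convergent sequences to strongly convergent ones). Then f is a real-analytic diffeomorphism (bijection with real-analytic inverse) from H onto H₁. -/

import Mathlib

/-- Abstract isomorphism theorem (Kargaev–Korotyaev): a real-analytic map `f` between
real separable Hilbert spaces whose derivative is everywhere a linear isomorphism,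
satisfying the a-priori bound `‖q‖ ≤ ε(‖f q‖)` with `ε` nondecreasing, `ε 0 = 0`, and
which is a compact perturbation of a linear isomorphism `f₀`, is a bijection with
real-analytic inverse. -/
theorem stmt12
    {H H₁ : Type*} [NormedAddCommGroup H] [InnerProductSpace ℝ H] [CompleteSpace H]
    [SecondCountableTopology H]
    [NormedAddCommGroup H₁] [InnerProductSpace ℝ H₁] [CompleteSpace H₁]
    [SecondCountableTopology H₁]
    (f : H → H₁)
    (hf_an : ∀ q : H, AnalyticAt ℝ f q)
    (hf_deriv : ∀ q : H, ∃ e : H ≃L[ℝ] H₁, (e : H →L[ℝ] H₁) = fderiv ℝ f q)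
    (ε : ℝ → ℝ) (hε_mono : MonotoneOn ε (Set.Ici 0)) (hε0 : ε 0 = 0)
    (hε : ∀ q : H, ‖q‖ ≤ ε ‖f q‖)
    (f₀ : H ≃L[ℝ] H₁)
    (hcmp : ∀ s : Set H, Bornology.IsBounded s →
      IsCompact (closure ((fun q => f q - f₀ q) '' s))) :
    Function.Bijective f ∧
      ∃ g : H₁ → H, (∀ p : H₁, AnalyticAt ℝ g p) ∧
        Function.LeftInverse g f ∧ Function.RightInverse g f := by
  have hs : ∀ q : H, ∃ e : H ≃L[ℝ] H₁, HasStrictFDerivAt f (e : H →L[ℝ] H₁) q := by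
    intro q
    obtain ⟨e, he⟩ := hf_deriv q
    exact ⟨e, he ▸ (hf_an q).hasStrictFDerivAt⟩
  have hc : Continuous f := continuous_iff_continuousAt.2 fun q => (hf_an q).continuousAt
  have hopen : IsOpenMap f := by
    rw [isOpenMap_iff_nhds_le]
    intro q
    obtain ⟨e, he⟩ := hs q
    exact he.map_nhds_eq_of_equiv.ge
  have hinj : ∀ q : H, ∃ U ∈ nhds q, Set.InjOn f U := by
    intro q
    obtain ⟨e, he⟩ := hs q
    refine ⟨(he.toOpenPartialHomeomorph f).source,
      (he.toOpenPartialHomeomorph f).open_source.mem_nhds he.mem_toOpenPartialHomeomorph_source, ?_⟩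
    exact (he.toOpenPartialHomeomorph f).injOn
  have hprop : IsProperMap f := by
    rw [isProperMap_iff_isCompact_preimage]
    refine ⟨hc, fun {K} hK => ?_⟩
    obtain ⟨R, hR⟩ := hK.isBounded.exists_norm_le
    have hB : Bornology.IsBounded (f ⁻¹' K) := by
      rw [isBounded_iff_forall_norm_le]
      refine ⟨ε R, fun q hq => (hε q).trans ?_⟩
      have h1 := hR _ hq
      exact hε_mono (norm_nonneg _) ((norm_nonneg _).trans h1) h1
    have h2 := (hK.prod (hcmp _ hB)).image (f := fun z : H₁ × H₁ => f₀.symm (z.1 - z.2))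
      (by fun_prop)
    refine h2.of_isClosed_subset (hK.isClosed.preimage hc) ?_
    intro q hq
    refine ⟨(f q, f q - f₀ q), ⟨hq, subset_closure ⟨q, hq, rfl⟩⟩, ?_⟩
    simp
  have hrange : Set.range f = Set.univ :=
    IsClopen.eq_univ ⟨hprop.isClosedMap.isClosed_range, hopen.isOpen_range⟩ ⟨f 0, 0, rfl⟩
  have hsurj : Function.Surjective f := Set.range_eq_univ.1 hrange
  have hzero : ∀ q, f q = 0 → q = 0 := by
    intro q hq
    have := hε q
    rw [hq, norm_zero, hε0] at this
    exact norm_le_zero_iff.1 this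
  let D : Set (H × H) := {z | f z.1 = f z.2 ∧ z.1 ≠ z.2}
  have hD : IsClosed D := by
    rw [← isOpen_compl_iff, isOpen_iff_mem_nhds]
    rintro ⟨a, b⟩ hab
    by_cases h : a = b
    · subst h
      obtain ⟨U, hU, hUi⟩ := hinj a
      filter_upwards [prod_mem_nhds hU hU] with z hz hzD
      exact hzD.2 (hUi hz.1 hz.2 hzD.1)
    · have hne : f a ≠ f b := fun h' => hab ⟨h', h⟩
      have ho : IsOpen {z : H × H | f z.1 ≠ f z.2} :=
        isOpen_ne_fun (hc.comp continuous_fst) (hc.comp continuous_snd)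
      filter_upwards [ho.mem_nhds hne] with z hz hzD
      exact hz hzD.1
  let M : Set H₁ := {p | ∃ q q', q ≠ q' ∧ f q = p ∧ f q' = p}
  have hMc : IsClosed M := by
    have h1 := (hprop.prodMap hprop).isClosedMap D hD
    have h2 : M = (fun p : H₁ => (p, p)) ⁻¹' (Prod.map f f '' D) := by
      ext p
      constructor
      · rintro ⟨q, q', hne, h, h'⟩
        exact ⟨(q, q'), ⟨h.trans h'.symm, hne⟩, Prod.ext h h'⟩
      · rintro ⟨⟨q, q'⟩, ⟨_, hne⟩, h⟩
        exact ⟨q, q', hne, congrArg Prod.fst h, congrArg Prod.snd h⟩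
    rw [h2]
    exact h1.preimage (by fun_prop)
  have hMo : IsOpen M := by
    rw [isOpen_iff_mem_nhds]
    rintro p ⟨q, q', hne, h, h'⟩
    obtain ⟨U, V, hU, hV, hqU, hqV, hUV⟩ := t2_separation hne
    have h1 := (hopen U hU).mem_nhds ⟨q, hqU, h⟩
    have h2 := (hopen V hV).mem_nhds ⟨q', hqV, h'⟩
    filter_upwards [h1, h2]
    rintro x ⟨a, ha, hax⟩ ⟨b, hb, hbx⟩
    exact ⟨a, b, fun hab => Set.disjoint_left.1 hUV ha (hab ▸ hb), hax, hbx⟩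
  have hinjf : Function.Injective f := by
    intro a b hab
    by_contra hne
    have hM : M = Set.univ := IsClopen.eq_univ ⟨hMc, hMo⟩ ⟨f a, a, b, hne, rfl, hab.symm⟩
    have h0 : (0 : H₁) ∈ M := hM ▸ Set.mem_univ _
    obtain ⟨q, q', hq, h, h'⟩ := h0
    exact hq ((hzero q h).trans (hzero q' h').symm)
  have hbij : Function.Bijective f := ⟨hinjf, hsurj⟩
  refine ⟨hbij, ?_⟩
  let E : H ≃ₜ H₁ := (Equiv.ofBijective f hbij).toHomeomorphOfContinuousOpen hc hopen
  refine ⟨E.symm, fun p => ?_, fun q => E.symm_apply_apply q, fun p => E.apply_symm_apply p⟩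
  obtain ⟨e, he⟩ := hf_deriv (E.symm p)
  exact E.toOpenPartialHomeomorph.analyticAt_symm (a := p) (i := e) (Set.mem_univ _)
    (hf_an (E.symm p)) he.symm
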